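/- arXiv:1811.01696 — 4 statements merged into one kernel-verified Lean document; each statement's English description precedes it below -/
import Mathlib

section
/- Let n ≥ 2, let M be a matroid on [n] = {1,…,n}, and let 0 < q ≤ 1. Then for every point w = (w_0, w_1, …, w_n) with all coordinates strictly positive, the Hessian matrix of the homogeneous multivariate Tutte polynomial Z_M, evaluated at w, has exactly one positive eigenvalue (counted with multiplicity). -/
open MvPolynomial Finset Matrix

/-- Rank-function axioms for a matroid on `[n]` (Oxley, Theorem 1.3.2). -/
def IsMatroidRank (n : ℕ) (rk : Finset (Fin n) → ℕ) : Prop :=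
  (∀ A, rk A ≤ A.card) ∧
  (∀ A B, A ⊆ B → rk A ≤ rk B) ∧
  (∀ A B : Finset (Fin n), rk (A ∪ B) + rk (A ∩ B) ≤ rk A + rk B)

/-- `Z^k_M(q, w)`. -/
noncomputable def Zk (n : ℕ) (q : ℝ) (rk : Finset (Fin n) → ℕ) (k : ℕ) :
    MvPolynomial (Fin n) ℝ :=
  ∑ A ∈ Finset.powersetCard k (Finset.univ : Finset (Fin n)),
    C (q ^ (-(rk A : ℤ))) * ∏ i ∈ A, X i

/-- The homogeneous multivariate Tutte polynomial. -/
noncomputable def ZM (n : ℕ) (q : ℝ) (rk : Finset (Fin n) → ℕ) :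
    MvPolynomial (Fin (n+1)) ℝ :=
  ∑ k ∈ Finset.range (n+1), rename Fin.succ (Zk n q rk (n-k)) * X 0 ^ k

/-- The Hessian matrix of a polynomial at a point. -/
noncomputable def hessian {N : ℕ} (F : MvPolynomial (Fin N) ℝ) (w : Fin N → ℝ) :
    Matrix (Fin N) (Fin N) ℝ :=
  Matrix.of fun i j => eval w (pderiv i (pderiv j F))


/-- A real bilinear form satisfying the reverse Cauchy–Schwarz inequality. -/
def IsLorentzianForm {ι : Type*} [Fintype ι] (B : Matrix ι ι ℝ) : Prop :=
  ∀ x y : ι → ℝ, 0 < y ⬝ᵥ B *ᵥ y → (x ⬝ᵥ B *ᵥ x) * (y ⬝ᵥ B *ᵥ y) ≤ (x ⬝ᵥ B *ᵥ y) ^ 2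

section LinearAlgebra

variable {ι : Type*} [Fintype ι]

lemma dotProduct_mulVec_symm {B : Matrix ι ι ℝ} (hB : B.IsSymm) (x y : ι → ℝ) :
    x ⬝ᵥ B *ᵥ y = y ⬝ᵥ B *ᵥ x := by
  rw [dotProduct_mulVec, ← mulVec_transpose, hB.eq, dotProduct_comm]

lemma isLorentzianForm_zero : IsLorentzianForm (0 : Matrix ι ι ℝ) := by
  intro x y _
  simp

lemma IsLorentzianForm.of_nonpos_on_hyperplane {B : Matrix ι ι ℝ} (hB : B.IsSymm)
    (l : ι → ℝ) (hl : ∀ z, l ⬝ᵥ z = 0 → z ⬝ᵥ B *ᵥ z ≤ 0) : IsLorentzianForm B := by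
  intro x y hy
  have hly : l ⬝ᵥ y ≠ 0 := fun h => (hl y h).not_gt hy
  set c := (l ⬝ᵥ x) / (l ⬝ᵥ y) with hc
  have hz := hl (x - c • y) (by
    rw [dotProduct_sub, dotProduct_smul, smul_eq_mul, hc, div_mul_cancel₀ _ hly, sub_self])
  simp only [mulVec_sub, mulVec_smul, dotProduct_sub, sub_dotProduct, dotProduct_smul,
    smul_dotProduct, smul_eq_mul, dotProduct_mulVec_symm hB y x] at hz
  nlinarith [mul_nonpos_of_nonpos_of_nonneg hz hy.le,
    sq_nonneg (c * (y ⬝ᵥ B *ᵥ y) - x ⬝ᵥ B *ᵥ y)]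

variable [DecidableEq ι]

lemma dotProduct_mulVec_eq_sum_eigenvalues {A : Matrix ι ι ℝ} (hA : A.IsHermitian) (x : ι → ℝ) :
    x ⬝ᵥ A *ᵥ x =
      ∑ k, hA.eigenvalues k * ((hA.eigenvectorBasis k : ι → ℝ) ⬝ᵥ x) ^ 2 := by
  have hs : A.IsSymm := by
    simpa [IsHermitian, IsSymm, conjTranspose_eq_transpose_of_trivial] using hA
  have h := hA.eigenvectorBasis.sum_inner_mul_inner (WithLp.toLp 2 x) (WithLp.toLp 2 (A *ᵥ x))
  simp only [EuclideanSpace.inner_eq_star_dotProduct, star_trivial] at h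
  rw [dotProduct_comm, ← h]
  refine Finset.sum_congr rfl fun k _ => ?_
  rw [dotProduct_comm (A *ᵥ x), dotProduct_mulVec_symm hs, hA.mulVec_eigenvectorBasis,
    dotProduct_smul, smul_eq_mul, dotProduct_comm x]
  ring

lemma eigenvectorBasis_dotProduct_mulVec {A : Matrix ι ι ℝ} (hA : A.IsHermitian) (i j : ι) :
    (hA.eigenvectorBasis i : ι → ℝ) ⬝ᵥ A *ᵥ (hA.eigenvectorBasis j : ι → ℝ) =
      if i = j then hA.eigenvalues j else 0 := by
  have h := orthonormal_iff_ite.mp hA.eigenvectorBasis.orthonormal i j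
  simp only [EuclideanSpace.inner_eq_star_dotProduct, star_trivial] at h
  rw [hA.mulVec_eigenvectorBasis, dotProduct_smul, dotProduct_comm, h]
  simp

/-- A Lorentzian form which is positive somewhere has exactly one positive eigenvalue. -/
lemma IsLorentzianForm.card_pos_eigenvalues {A : Matrix ι ι ℝ} (hL : IsLorentzianForm A)
    (hA : A.IsHermitian) (w : ι → ℝ) (hw : 0 < w ⬝ᵥ A *ᵥ w) :
    Fintype.card {i // 0 < hA.eigenvalues i} = 1 := by
  rw [Fintype.card_eq_one_iff]
  have hex : ∃ i, 0 < hA.eigenvalues i := by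
    by_contra! h
    rw [dotProduct_mulVec_eq_sum_eigenvalues hA] at hw
    exact hw.not_ge (Finset.sum_nonpos fun k _ =>
      mul_nonpos_of_nonpos_of_nonneg (h k) (sq_nonneg _))
  obtain ⟨i, hi⟩ := hex
  refine ⟨⟨i, hi⟩, fun ⟨j, hj⟩ => ?_⟩
  by_contra hne
  have hji : j ≠ i := fun h => hne (Subtype.ext h)
  have h := hL (hA.eigenvectorBasis j) (hA.eigenvectorBasis i)
  simp only [eigenvectorBasis_dotProduct_mulVec, if_true, if_neg hji] at h
  nlinarith [h hi, mul_pos hi hj]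

/-- If `x ⬝ᵥ Q *ᵥ x` is positive, then `x` has a component along an eigenvector with positive
eigenvalue of the generalized eigenvalue problem `Q u = lam D u`. -/
lemma exists_pos_generalized_eigenvector {Q : Matrix ι ι ℝ} (hQ : Q.IsSymm) (D : ι → ℝ)
    (hD : ∀ i, 0 < D i) (x : ι → ℝ) (hx : 0 < x ⬝ᵥ Q *ᵥ x) :
    ∃ (lam : ℝ) (u : ι → ℝ), 0 < lam ∧ (∀ i, (Q *ᵥ u) i = lam * (D i * u i)) ∧
      ∑ i, D i * u i * x i ≠ 0 := by
  have hs : ∀ i, 0 < √(D i) := fun i => Real.sqrt_pos.mpr (hD i)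
  have hss : ∀ i, √(D i) * √(D i) = D i := fun i => Real.mul_self_sqrt (hD i).le
  let A : Matrix ι ι ℝ := Matrix.of fun i j => Q i j / (√(D i) * √(D j))
  have hA : A.IsHermitian := by
    ext i j
    simp [A, hQ.apply i j, mul_comm]
  have hAx : (fun i => √(D i) * x i) ⬝ᵥ A *ᵥ (fun i => √(D i) * x i) = x ⬝ᵥ Q *ᵥ x := by
    simp only [dotProduct, mulVec, A, of_apply, Finset.mul_sum]
    refine Finset.sum_congr rfl fun i _ => Finset.sum_congr rfl fun j _ => ?_
    have := (hs i).ne'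
    have := (hs j).ne'
    field_simp
  rw [← hAx, dotProduct_mulVec_eq_sum_eigenvalues hA] at hx
  obtain ⟨k, -, hk⟩ := Finset.exists_lt_of_sum_lt (f := fun _ => (0 : ℝ)) (by simpa using hx)
  have hlam : 0 < hA.eigenvalues k := by
    by_contra! h
    exact hk.not_ge (mul_nonpos_of_nonpos_of_nonneg h (sq_nonneg _))
  have h2 (i : ι) :
      D i * (hA.eigenvectorBasis k i / √(D i)) = √(D i) * hA.eigenvectorBasis k i := by
    have hi := (hs i).ne'
    nth_rewrite 1 [← hss i]
    field_simp
  refine ⟨hA.eigenvalues k, fun i => hA.eigenvectorBasis k i / √(D i), hlam, fun i => ?_, ?_⟩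
  · have h := congrFun (hA.mulVec_eigenvectorBasis k) i
    simp only [mulVec, dotProduct, A, of_apply, Pi.smul_apply, smul_eq_mul] at h ⊢
    have hi := (hs i).ne'
    rw [h2 i, mul_left_comm, ← h, Finset.mul_sum]
    refine Finset.sum_congr rfl fun j _ => ?_
    have := (hs j).ne'
    field_simp
  · intro h0
    have : (hA.eigenvectorBasis k : ι → ℝ) ⬝ᵥ (fun i => √(D i) * x i) = 0 := by
      rw [← h0]
      refine Finset.sum_congr rfl fun i _ => ?_
      rw [h2 i]
      ring
    simp [this] at hk

/-- The inductive step: a nonnegative form whose directional derivatives `T i` are Lorentzian is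
Lorentzian, provided its support graph is connected through the vertex `o`. -/
lemma IsLorentzianForm.of_derivatives {Q : Matrix ι ι ℝ} {T : ι → Matrix ι ι ℝ} {w : ι → ℝ}
    {c : ℝ} {o : ι} (hc : 0 < c) (hw : ∀ i, 0 < w i) (hQ : Q.IsSymm) (hnn : ∀ i j, 0 ≤ Q i j)
    (hsupp : ∀ i, 0 < Q i o ∨ ((∀ j, Q i j = 0) ∧ T i = 0))
    (hT : ∀ i, IsLorentzianForm (T i))
    (hTsum : ∀ j k, ∑ i, w i * T i j k = c * Q j k)
    (hTw : ∀ i j, (T i *ᵥ w) j = c * Q i j) : IsLorentzianForm Q := by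
  set p : ι → ℝ := Q *ᵥ w with hp
  have hp_pos : ∀ i, 0 < Q i o → 0 < p i := fun i hi =>
    Finset.sum_pos' (fun j _ => mul_nonneg (hnn i j) (hw j).le)
      ⟨o, Finset.mem_univ _, mul_pos hi (hw o)⟩
  have hp_zero : ∀ i, (∀ j, Q i j = 0) → p i = 0 := fun i hi => by
    simp [hp, mulVec, dotProduct, hi]
  have key : ∀ x : ι → ℝ, x ⬝ᵥ Q *ᵥ x ≤ ∑ i, w i * ((Q *ᵥ x) i ^ 2 / p i) := by
    intro x
    have h1 : ∑ i, w i * (x ⬝ᵥ T i *ᵥ x) = c * (x ⬝ᵥ Q *ᵥ x) := by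
      simp only [dotProduct, mulVec, Finset.mul_sum]
      rw [Finset.sum_comm]
      refine Finset.sum_congr rfl fun j _ => ?_
      rw [Finset.sum_comm]
      refine Finset.sum_congr rfl fun k _ => ?_
      calc ∑ i, w i * (x j * (T i j k * x k)) = (∑ i, w i * T i j k) * (x j * x k) := by
            rw [Finset.sum_mul]; exact Finset.sum_congr rfl fun i _ => by ring
        _ = _ := by rw [hTsum]; ring
    have h2 : ∀ i, w i * (x ⬝ᵥ T i *ᵥ x) ≤ c * (w i * ((Q *ᵥ x) i ^ 2 / p i)) := by
      intro i
      rcases hsupp i with hi | ⟨hi, hTi⟩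
      · have hpi := hp_pos i hi
        have hwT : w ⬝ᵥ T i *ᵥ w = c * p i := by
          simp only [hp, mulVec, dotProduct, Finset.mul_sum] at hTw ⊢
          refine Finset.sum_congr rfl fun j _ => ?_
          rw [← Finset.mul_sum, hTw]; ring
        have hxT : x ⬝ᵥ T i *ᵥ w = c * (Q *ᵥ x) i := by
          simp only [mulVec, dotProduct, Finset.mul_sum] at hTw ⊢
          refine Finset.sum_congr rfl fun j _ => ?_
          rw [← Finset.mul_sum, hTw]; ring
        have h := hT i x w (by rw [hwT]; positivity)
        rw [hwT, hxT] at h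
        have h3 : x ⬝ᵥ T i *ᵥ x ≤ c * ((Q *ᵥ x) i ^ 2 / p i) := by
          rw [← mul_div_assoc, le_div_iff₀ hpi]
          refine le_of_mul_le_mul_left ?_ hc
          linarith
        calc _ ≤ w i * (c * ((Q *ᵥ x) i ^ 2 / p i)) := mul_le_mul_of_nonneg_left h3 (hw i).le
          _ = _ := by ring
      · simp [hTi, hp_zero i hi]
    refine le_of_mul_le_mul_left ?_ hc
    rw [← h1, Finset.mul_sum]
    exact Finset.sum_le_sum fun i _ => h2 i
  refine .of_nonpos_on_hyperplane hQ p fun x hx => ?_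
  by_contra! hpos
  let D : ι → ℝ := fun i => if p i = 0 then 1 else p i / w i
  have hD : ∀ i, 0 < D i := by
    intro i
    rcases hsupp i with hi | ⟨hi, -⟩
    · have := hp_pos i hi
      simp only [D, if_neg this.ne']
      exact div_pos this (hw i)
    · simp [D, hp_zero i hi]
  obtain ⟨lam, u, hlam, hu, hux⟩ := exists_pos_generalized_eigenvector hQ D hD x hpos
  have hu_zero : ∀ i, (∀ j, Q i j = 0) → u i = 0 := by
    intro i hi
    have h := hu i
    have h0 : (Q *ᵥ u) i = 0 := by simp [mulVec, dotProduct, hi]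
    rw [h0] at h
    simpa [hlam.ne', (hD i).ne'] using h.symm
  have hDu : ∀ i, D i * u i = p i * (u i / w i) := by
    intro i
    rcases hsupp i with hi | ⟨hi, -⟩
    · simp only [D, if_neg (hp_pos i hi).ne']
      ring
    · simp [hu_zero i hi]
  have huQ : u ⬝ᵥ Q *ᵥ u = lam * ∑ i, D i * u i * u i := by
    rw [dotProduct, Finset.mul_sum]
    exact Finset.sum_congr rfl fun i _ => by rw [hu i]; ring
  have hnorm : 0 < ∑ i, D i * u i * u i := by
    have hne : ∃ i, u i ≠ 0 := by
      by_contra! h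
      simp [h] at hux
    obtain ⟨i, hi⟩ := hne
    refine Finset.sum_pos' (fun j _ => ?_) ⟨i, Finset.mem_univ _, ?_⟩
    · rw [mul_assoc]; exact mul_nonneg (hD j).le (mul_self_nonneg _)
    · rw [mul_assoc]; exact mul_pos (hD i) (mul_self_pos.mpr hi)
  have hlam1 : 1 ≤ lam := by
    have h := key u
    have h2 : ∑ i, w i * ((Q *ᵥ u) i ^ 2 / p i) = lam ^ 2 * ∑ i, D i * u i * u i := by
      rw [Finset.mul_sum]
      refine Finset.sum_congr rfl fun i _ => ?_
      rcases hsupp i with hi | ⟨hi, -⟩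
      · have := (hp_pos i hi).ne'
        have := (hw i).ne'
        rw [hu i, hDu i]
        field_simp
      · simp [hu_zero i hi, hp_zero i hi]
    rw [huQ, h2] at h
    have h3 : 0 < lam * ∑ i, D i * u i * u i := mul_pos hlam hnorm
    by_contra! hlt
    nlinarith [mul_pos h3 (sub_pos.mpr hlt)]
  have hle : ∑ i, D i * u i * u i ≤ u ⬝ᵥ Q *ᵥ u := by
    rw [huQ]; nlinarith
  set z : ι → ℝ := fun i => u i / w i with hz
  have huz : ∀ i, u i = w i * z i := fun i => by
    rw [hz]; field_simp [(hw i).ne']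
  have hdir : ∑ i, ∑ j, Q i j * w i * w j * (z i - z j) ^ 2 ≤ 0 := by
    have e1 : ∑ i, D i * u i * u i = ∑ i, ∑ j, Q i j * w i * w j * z i ^ 2 := by
      refine Finset.sum_congr rfl fun i _ => ?_
      rw [hDu i, huz i, hp, mulVec, dotProduct, Finset.sum_mul, Finset.sum_mul]
      refine Finset.sum_congr rfl fun j _ => ?_
      have := (hw i).ne'
      field_simp
    have e2 : ∑ i, D i * u i * u i = ∑ i, ∑ j, Q i j * w i * w j * z j ^ 2 := by
      rw [e1, Finset.sum_comm]
      refine Finset.sum_congr rfl fun i _ => Finset.sum_congr rfl fun j _ => ?_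
      rw [hQ.apply i j]; ring
    have e3 : u ⬝ᵥ Q *ᵥ u = ∑ i, ∑ j, Q i j * w i * w j * (z i * z j) := by
      simp only [dotProduct, mulVec, Finset.mul_sum]
      refine Finset.sum_congr rfl fun i _ => Finset.sum_congr rfl fun j _ => ?_
      rw [huz i, huz j]; ring
    have e4 : ∑ i, ∑ j, Q i j * w i * w j * (z i - z j) ^ 2 =
        ∑ i, ∑ j, Q i j * w i * w j * z i ^ 2 + ∑ i, ∑ j, Q i j * w i * w j * z j ^ 2
          - 2 * ∑ i, ∑ j, Q i j * w i * w j * (z i * z j) := by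
      simp only [Finset.mul_sum, ← Finset.sum_add_distrib, ← Finset.sum_sub_distrib]
      refine Finset.sum_congr rfl fun i _ => Finset.sum_congr rfl fun j _ => ?_
      ring
    rw [e4, ← e1, ← e2, ← e3]
    linarith
  have hterm : ∀ i j, 0 ≤ Q i j * w i * w j * (z i - z j) ^ 2 := fun i j =>
    mul_nonneg (mul_nonneg (mul_nonneg (hnn i j) (hw i).le) (hw j).le) (sq_nonneg _)
  have hconst : ∀ i, 0 < Q i o → z i = z o := by
    intro i hi
    have h1 : Q i o * w i * w o * (z i - z o) ^ 2 ≤ 0 :=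
      ((Finset.single_le_sum (f := fun j => Q i j * w i * w j * (z i - z j) ^ 2)
        (fun j _ => hterm i j) (Finset.mem_univ o)).trans
        (Finset.single_le_sum (f := fun i => ∑ j, Q i j * w i * w j * (z i - z j) ^ 2)
          (fun i _ => Finset.sum_nonneg fun j _ => hterm i j) (Finset.mem_univ i))).trans hdir
    have h2 : 0 < Q i o * w i * w o := mul_pos (mul_pos hi (hw i)) (hw o)
    have h3 : (z i - z o) ^ 2 = 0 := le_antisymm (by nlinarith) (sq_nonneg _)
    exact sub_eq_zero.mp (pow_eq_zero_iff two_ne_zero |>.mp h3)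
  refine hux ?_
  calc ∑ i, D i * u i * x i = ∑ i, z o * (p i * x i) := by
        refine Finset.sum_congr rfl fun i _ => ?_
        rw [hDu i]
        rcases hsupp i with hi | ⟨hi, -⟩
        · rw [← hconst i hi]; ring
        · simp [hp_zero i hi]
    _ = z o * (p ⬝ᵥ x) := by rw [dotProduct, Finset.mul_sum]
    _ = 0 := by rw [hx, mul_zero]

end LinearAlgebra

section IteratedDerivatives

/-- The iterated partial derivative along a list of variables. -/
noncomputable def iterPDeriv {σ : Type*} (L : List σ) (F : MvPolynomial σ ℝ) : MvPolynomial σ ℝ :=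
  L.foldr (fun i p => pderiv i p) F

variable {σ : Type*}

@[simp] lemma iterPDeriv_cons (i : σ) (L : List σ) (F : MvPolynomial σ ℝ) :
    iterPDeriv (i :: L) F = pderiv i (iterPDeriv L F) := rfl

lemma pderiv_pderiv_comm (i j : σ) (F : MvPolynomial σ ℝ) :
    pderiv i (pderiv j F) = pderiv j (pderiv i F) := by
  classical
  ext m
  simp only [coeff_pderiv, Finsupp.add_apply, Finsupp.single_apply, add_right_comm m]
  by_cases h : i = j
  · subst h; rfl
  · simp [h, Ne.symm h]; ring

lemma iterPDeriv_perm {L L' : List σ} (h : L.Perm L') (F : MvPolynomial σ ℝ) :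
    iterPDeriv L F = iterPDeriv L' F :=
  haveI : LeftCommutative (fun (i : σ) (p : MvPolynomial σ ℝ) => pderiv i p) :=
    ⟨pderiv_pderiv_comm⟩
  h.foldr_eq F

lemma isHomogeneous_iterPDeriv {F : MvPolynomial σ ℝ} {n : ℕ} (hF : F.IsHomogeneous n)
    (L : List σ) : (iterPDeriv L F).IsHomogeneous (n - L.length) := by
  induction L with
  | nil => exact hF
  | cons i L ih => exact ih.pderiv

lemma coeff_iterPDeriv [Fintype σ] [DecidableEq σ] (F : MvPolynomial σ ℝ) (L : List σ)
    (m : σ →₀ ℕ) :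
    (∏ l, ((m l).factorial : ℝ)) * coeff m (iterPDeriv L F) =
      (∏ l, ((m l + L.count l).factorial : ℝ)) *
        coeff (m + Multiset.toFinsupp (L : Multiset σ)) F := by
  induction L generalizing m with
  | nil => simp [iterPDeriv]
  | cons i L ih =>
    have hm : m + Multiset.toFinsupp ((i :: L : List σ) : Multiset σ) =
        m + Finsupp.single i 1 + Multiset.toFinsupp (L : Multiset σ) := by
      rw [← Multiset.cons_coe, ← Multiset.singleton_add, map_add, Multiset.toFinsupp_singleton,
        add_assoc]
    have hc : ∀ l, m l + (i :: L).count l = (m + Finsupp.single i 1 : σ →₀ ℕ) l + L.count l := by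
      intro l
      simp only [List.count_cons, Finsupp.add_apply, Finsupp.single_apply, beq_iff_eq]
      ring
    have hf : (∏ l, (((m + Finsupp.single i 1 : σ →₀ ℕ) l).factorial : ℝ)) =
        (∏ l, ((m l).factorial : ℝ)) * (m i + 1) := by
      rw [← Finset.mul_prod_erase _ _ (Finset.mem_univ i),
        ← Finset.mul_prod_erase _ _ (Finset.mem_univ i)]
      have : ∀ l ∈ Finset.univ.erase i, (((m + Finsupp.single i 1 : σ →₀ ℕ) l).factorial : ℝ) =
          (m l).factorial := by
        intro l hl
        rw [Finsupp.add_apply, Finsupp.single_eq_of_ne (Finset.ne_of_mem_erase hl), add_zero]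
      rw [Finset.prod_congr rfl this]
      simp [Nat.factorial_succ]
      ring
    rw [hm]
    simp only [hc]
    rw [← ih, hf, iterPDeriv_cons, coeff_pderiv]
    ring

lemma eval_iterPDeriv_of_length_eq [Fintype σ] [DecidableEq σ] {F : MvPolynomial σ ℝ} {n : ℕ}
    (hF : F.IsHomogeneous n) {L : List σ} (hL : L.length = n) (w : σ → ℝ) :
    eval w (iterPDeriv L F) =
      (∏ l, ((L.count l).factorial : ℝ)) * coeff (Multiset.toFinsupp (L : Multiset σ)) F := by
  have h0 : (iterPDeriv L F).IsHomogeneous 0 := by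
    simpa [hL] using isHomogeneous_iterPDeriv hF L
  have hC := totalDegree_eq_zero_iff_eq_C.mp (Nat.le_zero.mp h0.totalDegree_le)
  have h := coeff_iterPDeriv F L 0
  rw [hC, eval_C]
  simpa using h

/-- Euler's identity for iterated derivatives. -/
lemma sum_mul_eval_iterPDeriv_cons [Fintype σ] {F : MvPolynomial σ ℝ} {n : ℕ}
    (hF : F.IsHomogeneous n) (L : List σ) (w : σ → ℝ) :
    ∑ i, w i * eval w (iterPDeriv (i :: L) F) = (n - L.length : ℕ) * eval w (iterPDeriv L F) := by
  have h := congrArg (eval w) (isHomogeneous_iterPDeriv hF L).sum_X_mul_pderiv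
  simpa using h

end IteratedDerivatives

section TuttePolynomial

variable {n : ℕ}

/-- The exponent of the monomial of `ZM` that belongs to the set `A`. -/
noncomputable def tutteExponent (A : Finset (Fin n)) : Fin (n + 1) →₀ ℕ :=
  Finsupp.single 0 (n - #A) + ∑ i ∈ A, Finsupp.single i.succ 1

lemma tutteExponent_zero (A : Finset (Fin n)) : tutteExponent A 0 = n - #A := by
  simp [tutteExponent]

lemma tutteExponent_succ (A : Finset (Fin n)) (j : Fin n) :
    tutteExponent A j.succ = if j ∈ A then 1 else 0 := by
  simp [tutteExponent, Finsupp.single_apply]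

lemma ZM_eq_sum_monomial (q : ℝ) (rk : Finset (Fin n) → ℕ) :
    ZM n q rk = ∑ A : Finset (Fin n), monomial (tutteExponent A) (q ^ (-(rk A : ℤ))) := by
  have hmono : ∀ A : Finset (Fin n), monomial (tutteExponent A) (q ^ (-(rk A : ℤ))) =
      (C (q ^ (-(rk A : ℤ))) * ∏ i ∈ A, X i.succ) * X (0 : Fin (n + 1)) ^ (n - #A) := by
    intro A
    have h : ∏ i ∈ A, (X i.succ : MvPolynomial (Fin (n + 1)) ℝ) =
        monomial (∑ i ∈ A, Finsupp.single i.succ 1) 1 := by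
      rw [monomial_sum_one]; rfl
    rw [h, X_pow_eq_monomial, C_mul_monomial, monomial_mul, tutteExponent, mul_one, mul_one,
      add_comm (Finsupp.single _ _)]
  simp only [hmono]
  rw [← Finset.powerset_univ, Finset.sum_powerset, Finset.card_univ, Fintype.card_fin, ZM,
    ← Finset.sum_flip]
  refine Finset.sum_congr rfl fun k hk => ?_
  rw [Nat.sub_sub_self (Finset.mem_range_succ_iff.mp hk), Zk, map_sum, Finset.sum_mul]
  refine Finset.sum_congr rfl fun A hA => ?_
  simp [(Finset.mem_powersetCard.mp hA).2]

lemma isHomogeneous_ZM (q : ℝ) (rk : Finset (Fin n) → ℕ) : (ZM n q rk).IsHomogeneous n := by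
  rw [ZM_eq_sum_monomial]
  refine IsHomogeneous.sum _ _ _ fun A _ => isHomogeneous_monomial _ ?_
  rw [Finsupp.degree_eq_sum, Fin.sum_univ_succ, tutteExponent_zero]
  simp only [tutteExponent_succ, Finset.sum_boole, Finset.filter_mem_eq_inter, Finset.univ_inter,
    Nat.cast_id]
  exact Nat.sub_add_cancel (by simpa using Finset.card_le_univ A)

/-- The elements of `Fin n` whose variable occurs in the list `L`. -/
def succSupport (L : List (Fin (n + 1))) : Finset (Fin n) := Finset.univ.filter (·.succ ∈ L)

lemma mem_succSupport {L : List (Fin (n + 1))} {j : Fin n} : j ∈ succSupport L ↔ j.succ ∈ L := by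
  simp [succSupport]

lemma succSupport_zero_cons (L : List (Fin (n + 1))) : succSupport (0 :: L) = succSupport L := by
  ext j
  simp [mem_succSupport]

lemma succSupport_succ_cons (j : Fin n) (L : List (Fin (n + 1))) :
    succSupport (j.succ :: L) = insert j (succSupport L) := by
  ext i
  simp [mem_succSupport]

/-- No variable other than the homogenizing one is repeated in `L`. -/
def IsSquarefreeList (L : List (Fin (n + 1))) : Prop := ∀ j : Fin n, L.count j.succ ≤ 1

lemma IsSquarefreeList.zero_cons {L : List (Fin (n + 1))} :
    IsSquarefreeList (0 :: L) ↔ IsSquarefreeList L := by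
  simp [IsSquarefreeList, (Fin.succ_ne_zero _).symm]

lemma IsSquarefreeList.succ_cons {L : List (Fin (n + 1))} {j : Fin n} :
    IsSquarefreeList (j.succ :: L) ↔ IsSquarefreeList L ∧ j ∉ succSupport L := by
  simp only [IsSquarefreeList, mem_succSupport, List.count_cons, beq_iff_eq,
    Fin.succ_inj, ← List.count_eq_zero]
  constructor
  · intro h
    refine ⟨fun i => (Nat.le_add_right _ _).trans (h i), ?_⟩
    have := h j
    simp at this
    simpa using this
  · rintro ⟨h, hj⟩ i
    by_cases hij : j = i
    · subst hij; simp [hj]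
    · simpa [hij] using h i

lemma IsSquarefreeList.of_cons {L : List (Fin (n + 1))} {i : Fin (n + 1)}
    (h : IsSquarefreeList (i :: L)) : IsSquarefreeList L := by
  cases i using Fin.cases with
  | zero => exact zero_cons.mp h
  | succ j => exact (succ_cons.mp h).1

lemma IsSquarefreeList.count_succ {L : List (Fin (n + 1))} (h : IsSquarefreeList L) (j : Fin n) :
    L.count j.succ = if j ∈ succSupport L then 1 else 0 := by
  split_ifs with hj <;> rw [mem_succSupport] at hj
  · exact le_antisymm (h j) (List.count_pos_iff.mpr hj)
  · exact List.count_eq_zero.mpr hj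

lemma IsSquarefreeList.count_zero {L : List (Fin (n + 1))} (h : IsSquarefreeList L) :
    L.count 0 + #(succSupport L) = L.length := by
  have hsum : ∑ i, L.count i = L.length := by
    simpa using Multiset.sum_count_eq_card (s := Finset.univ) (m := (L : Multiset (Fin (n + 1))))
      (fun _ _ => Finset.mem_univ _)
  rw [← hsum, Fin.sum_univ_succ]
  simp [h.count_succ]

variable {q : ℝ} {rk : Finset (Fin n) → ℕ}

lemma eval_iterPDeriv_ZM_of_isSquarefreeList {L : List (Fin (n + 1))} (hL : L.length = n)
    (h : IsSquarefreeList L) (w : Fin (n + 1) → ℝ) :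
    eval w (iterPDeriv L (ZM n q rk)) =
      (L.count 0).factorial * q ^ (-(rk (succSupport L) : ℤ)) := by
  have hexp : Multiset.toFinsupp (L : Multiset (Fin (n + 1))) = tutteExponent (succSupport L) := by
    ext i
    cases i using Fin.cases with
    | zero =>
      have := h.count_zero
      simp [tutteExponent_zero]
      omega
    | succ j => simp [tutteExponent_succ, h.count_succ]
  have hinj : ∀ A : Finset (Fin n), tutteExponent A = tutteExponent (succSupport L) →
      A = succSupport L := by
    intro A hA
    ext j
    have := DFunLike.congr_fun hA j.succ
    simp only [tutteExponent_succ] at this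
    split_ifs at this <;> simp_all
  rw [eval_iterPDeriv_of_length_eq (isHomogeneous_ZM q rk) hL, hexp, ZM_eq_sum_monomial,
    coeff_sum, Finset.sum_eq_single (succSupport L), coeff_monomial, if_pos rfl,
    Fin.prod_univ_succ]
  · congr 1
    rw [Finset.prod_eq_one, mul_one]
    intro j _
    rw [h.count_succ]
    split_ifs <;> simp
  · intro A _ hA
    rw [coeff_monomial, if_neg fun e => hA (hinj A e)]
  · simp

lemma eval_iterPDeriv_ZM_of_not_isSquarefreeList_of_length {L : List (Fin (n + 1))}
    (hL : L.length = n) (h : ¬ IsSquarefreeList L) (w : Fin (n + 1) → ℝ) :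
    eval w (iterPDeriv L (ZM n q rk)) = 0 := by
  rw [eval_iterPDeriv_of_length_eq (isHomogeneous_ZM q rk) hL, ZM_eq_sum_monomial, coeff_sum,
    Finset.sum_eq_zero, mul_zero]
  intro A _
  rw [coeff_monomial, if_neg]
  intro e
  refine h fun j => ?_
  have := DFunLike.congr_fun e j.succ
  rw [tutteExponent_succ] at this
  simp only [Multiset.toFinsupp_apply, Multiset.coe_count] at this
  rw [← this]
  split_ifs <;> simp

lemma eval_iterPDeriv_ZM_pos_or_eq_zero (hq : 0 < q) {w : Fin (n + 1) → ℝ} (hw : ∀ i, 0 < w i)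
    (d : ℕ) (L : List (Fin (n + 1))) (hL : L.length + d = n) :
    (IsSquarefreeList L → 0 < eval w (iterPDeriv L (ZM n q rk))) ∧
      (¬ IsSquarefreeList L → eval w (iterPDeriv L (ZM n q rk)) = 0) := by
  induction d generalizing L with
  | zero =>
    refine ⟨fun h => ?_, fun h => ?_⟩
    · rw [eval_iterPDeriv_ZM_of_isSquarefreeList (by simpa using hL) h]
      positivity
    · exact eval_iterPDeriv_ZM_of_not_isSquarefreeList_of_length (by simpa using hL) h w
  | succ d ih =>
    have hE := sum_mul_eval_iterPDeriv_cons (isHomogeneous_ZM q rk) L w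
    have hd : n - L.length = d + 1 := by omega
    have ih' : ∀ i, _ := fun i => ih (i :: L) (by simp; omega)
    rw [hd] at hE
    have hd0 : (0 : ℝ) < (d + 1 : ℕ) := by positivity
    refine ⟨fun h => ?_, fun h => ?_⟩
    · have hpos : 0 < ∑ i, w i * eval w (iterPDeriv (i :: L) (ZM n q rk)) := by
        refine Finset.sum_pos' (fun i _ => mul_nonneg (hw i).le ?_) ⟨0, Finset.mem_univ _,
          mul_pos (hw 0) ((ih' 0).1 (IsSquarefreeList.zero_cons.mpr h))⟩
        by_cases hi : IsSquarefreeList (i :: L)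
        · exact ((ih' i).1 hi).le
        · exact ((ih' i).2 hi).ge
      rw [hE] at hpos
      exact pos_of_mul_pos_right hpos hd0.le
    · rw [Finset.sum_eq_zero fun i _ => by rw [(ih' i).2 fun h' => h h'.of_cons, mul_zero]] at hE
      exact (mul_eq_zero.mp hE.symm).resolve_left hd0.ne'

end TuttePolynomial

section Parallel

lemma card_mul_sum_le_card_sub_one_mul_sq {α : Type*} [DecidableEq α] (J : Finset α) (f : α → α)
    {q : ℝ} (hq0 : 0 ≤ q) (hq1 : q ≤ 1) (y : α → ℝ) :
    #J * ∑ i ∈ J, ∑ j ∈ J, (if i = j then 0 else (if f i = f j then q else 1) * (y i * y j)) ≤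
      (#J - 1) * (∑ i ∈ J, y i) ^ 2 := by
  have hdecomp : ∑ i ∈ J, ∑ j ∈ J,
        (if i = j then 0 else (if f i = f j then q else 1) * (y i * y j)) =
      (∑ i ∈ J, y i) ^ 2 - q * ∑ i ∈ J, y i ^ 2
        - (1 - q) * ∑ i ∈ J, ∑ j ∈ J, (if f i = f j then y i * y j else 0) := by
    have hdiag : ∑ i ∈ J, y i ^ 2 = ∑ i ∈ J, ∑ j ∈ J, (if i = j then y i * y j else 0) := by
      refine Finset.sum_congr rfl fun i hi => ?_
      rw [Finset.sum_ite_eq, if_pos hi, sq]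
    rw [hdiag, sq, Finset.sum_mul_sum]
    simp only [Finset.mul_sum, ← Finset.sum_sub_distrib]
    refine Finset.sum_congr rfl fun i _ => Finset.sum_congr rfl fun j _ => ?_
    by_cases hij : i = j
    · subst hij
      simp only [if_true]
      ring
    · by_cases hf : f i = f j
      · simp only [if_neg hij, if_pos hf]; ring
      · simp only [if_neg hij, if_neg hf]; ring
  have hfib : ∑ i ∈ J, ∑ j ∈ J, (if f i = f j then y i * y j else 0) =
      ∑ c ∈ J.image f, (∑ i ∈ J with f i = c, y i) ^ 2 := by
    rw [← Finset.sum_fiberwise_of_maps_to (fun i hi => Finset.mem_image_of_mem f hi)]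
    refine Finset.sum_congr rfl fun c _ => ?_
    rw [sq, Finset.sum_mul_sum]
    refine Finset.sum_congr rfl fun i hi => ?_
    rw [Finset.sum_filter]
    refine Finset.sum_congr rfl fun j _ => ?_
    rw [(Finset.mem_filter.mp hi).2]
    simp only [eq_comm]
  have hcs1 : (∑ i ∈ J, y i) ^ 2 ≤ #J * ∑ i ∈ J, y i ^ 2 := sq_sum_le_card_mul_sum_sq
  have hcs2 : (∑ i ∈ J, y i) ^ 2 ≤
      #J * ∑ i ∈ J, ∑ j ∈ J, (if f i = f j then y i * y j else 0) := by
    rw [hfib]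
    calc (∑ i ∈ J, y i) ^ 2 = (∑ c ∈ J.image f, ∑ i ∈ J with f i = c, y i) ^ 2 := by
          rw [Finset.sum_fiberwise_of_maps_to fun i hi => Finset.mem_image_of_mem f hi]
      _ ≤ #(J.image f) * ∑ c ∈ J.image f, (∑ i ∈ J with f i = c, y i) ^ 2 :=
          sq_sum_le_card_mul_sum_sq
      _ ≤ _ := mul_le_mul_of_nonneg_right (by exact_mod_cast Finset.card_image_le)
          (Finset.sum_nonneg fun _ _ => sq_nonneg _)
  rw [hdecomp]
  nlinarith [mul_le_mul_of_nonneg_left hcs1 hq0,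
    mul_le_mul_of_nonneg_left hcs2 (sub_nonneg.mpr hq1)]

variable {n : ℕ} {rk : Finset (Fin n) → ℕ}

lemma IsMatroidRank.insert_le (hrk : IsMatroidRank n rk) (S : Finset (Fin n)) (i : Fin n) :
    rk (insert i S) ≤ rk S + 1 := by
  have h1 := hrk.2.2 S {i}
  have h2 := hrk.1 {i}
  rw [Finset.union_comm, ← Finset.insert_eq] at h1
  rw [Finset.card_singleton] at h2
  omega

lemma IsMatroidRank.le_insert (hrk : IsMatroidRank n rk) (S : Finset (Fin n)) (i : Fin n) :
    rk S ≤ rk (insert i S) := hrk.2.1 _ _ (Finset.subset_insert _ _)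

/-- Two elements are parallel in the contraction by `S` (loops being parallel to themselves
only). -/
def IsParallel (rk : Finset (Fin n) → ℕ) (S : Finset (Fin n)) (i j : Fin n) : Prop :=
  i = j ∨ (rk (insert i S) = rk S + 1 ∧ rk (insert j S) = rk S + 1 ∧
    rk (insert i (insert j S)) = rk S + 1)

lemma IsParallel.equivalence (hrk : IsMatroidRank n rk) (S : Finset (Fin n)) :
    Equivalence (IsParallel rk S) where
  refl _ := .inl rfl
  symm := by
    rintro i j (rfl | ⟨hi, hj, hij⟩)
    · exact .inl rfl
    · exact .inr ⟨hj, hi, by rwa [Finset.insert_comm]⟩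
  trans := by
    rintro i j k (rfl | ⟨hi, hj, hij⟩) h
    · exact h
    rcases h with rfl | ⟨-, hk, hjk⟩
    · exact .inr ⟨hi, hj, hij⟩
    refine .inr ⟨hi, hk, ?_⟩
    have h1 := hrk.2.2 (insert i (insert j S)) (insert j (insert k S))
    have h2 := hrk.2.1 (insert j S) (insert i (insert j S) ∩ insert j (insert k S)) (by
      intro x; simp only [Finset.mem_inter, Finset.mem_insert]; tauto)
    have h3 := hrk.2.1 (insert i (insert k S)) (insert i (insert j S) ∪ insert j (insert k S)) (by
      intro x; simp only [Finset.mem_union, Finset.mem_insert]; tauto)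
    have h4 := hrk.2.1 (insert i S) (insert i (insert k S))
      (Finset.insert_subset_insert _ (Finset.subset_insert _ _))
    omega

lemma exists_parallel_class_map (hrk : IsMatroidRank n rk) (S : Finset (Fin n)) :
    ∃ f : Fin n → Fin n, ∀ i j, f i = f j ↔ IsParallel rk S i j := by
  let s : Setoid (Fin n) := ⟨IsParallel rk S, IsParallel.equivalence hrk S⟩
  exact ⟨fun i => (Quotient.mk s i).out, fun i j => Quotient.out_inj.trans Quotient.eq⟩

lemma zpow_neg_rank_mul (hrk : IsMatroidRank n rk) {q : ℝ} (hq : 0 < q) {S : Finset (Fin n)}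
    {f : Fin n → Fin n} (hf : ∀ i j, f i = f j ↔ IsParallel rk S i j) {i j : Fin n}
    (hij : i ≠ j) :
    q ^ (-(rk S : ℤ)) * q ^ (-(rk (insert i (insert j S)) : ℤ)) =
      (if f i = f j then q else 1) *
        (q ^ (-(rk (insert i S) : ℤ)) * q ^ (-(rk (insert j S) : ℤ))) := by
  have h1 := hrk.insert_le S i
  have h2 := hrk.insert_le S j
  have h3 := hrk.le_insert S i
  have h4 := hrk.le_insert S j
  have h5 := hrk.le_insert (insert j S) i
  have h6 := hrk.le_insert (insert i S) j
  rw [Finset.insert_comm] at h6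
  have h7 := hrk.2.2 (insert i S) (insert j S)
  have h8 : insert i S ∪ insert j S = insert i (insert j S) := by
    ext x; simp only [Finset.mem_union, Finset.mem_insert]; tauto
  have h9 := hrk.2.1 S (insert i S ∩ insert j S)
    (Finset.subset_inter (Finset.subset_insert _ _) (Finset.subset_insert _ _))
  rw [h8] at h7
  rw [← zpow_add₀ hq.ne', ← zpow_add₀ hq.ne']
  split_ifs with h
  · obtain h | ⟨ha, hb, hc⟩ := (hf i j).mp h
    · exact absurd h hij
    · nth_rewrite 2 [← zpow_one q]
      rw [← zpow_add₀ hq.ne']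
      congr 1
      omega
  · rw [hf, IsParallel] at h
    push Not at h
    rw [one_mul]
    congr 1
    have := h.2
    omega

end Parallel

section Hessian

variable {n : ℕ} {rk : Finset (Fin n) → ℕ} {q : ℝ}

lemma hessian_iterPDeriv_apply {N : ℕ} (F : MvPolynomial (Fin N) ℝ) (L : List (Fin N))
    (w : Fin N → ℝ) (i j : Fin N) :
    hessian (iterPDeriv L F) w i j = eval w (iterPDeriv (i :: j :: L) F) := rfl

lemma isSymm_hessian {N : ℕ} (F : MvPolynomial (Fin N) ℝ) (w : Fin N → ℝ) :
    (hessian F w).IsSymm := by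
  ext i j
  simp [hessian, pderiv_pderiv_comm i j]

lemma isLorentzianForm_hessian_of_length_add_two (hrk : IsMatroidRank n rk) (hq0 : 0 < q)
    (hq1 : q ≤ 1) {L : List (Fin (n + 1))} (hL : L.length + 2 = n) (h : IsSquarefreeList L)
    (w : Fin (n + 1) → ℝ) : IsLorentzianForm (hessian (iterPDeriv L (ZM n q rk)) w) := by
  set S := succSupport L with hS
  set k := L.count 0 with hk
  set H := hessian (iterPDeriv L (ZM n q rk)) w with hH
  set a : Finset (Fin n) → ℝ := fun A => q ^ (-(rk A : ℤ)) with ha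
  have hsymm : H.IsSymm := isSymm_hessian _ _
  have hlen : ∀ i j : Fin (n + 1), (i :: j :: L).length = n := fun i j => by simpa using hL
  have hcard : #Sᶜ = k + 2 := by
    rw [Finset.card_compl, Fintype.card_fin]
    have := h.count_zero
    rw [← hS, ← hk] at this
    omega
  have h00 : H 0 0 = (k + 2).factorial * a S := by
    rw [hH, hessian_iterPDeriv_apply, eval_iterPDeriv_ZM_of_isSquarefreeList (hlen _ _)
      (IsSquarefreeList.zero_cons.mpr (IsSquarefreeList.zero_cons.mpr h))]
    simp [succSupport_zero_cons, ha, hS, hk]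
  have h0j : ∀ j : Fin n,
      H 0 j.succ = if j ∈ Sᶜ then (k + 1).factorial * a (insert j S) else 0 := by
    intro j
    rw [hH, hessian_iterPDeriv_apply]
    split_ifs with hj
    · rw [eval_iterPDeriv_ZM_of_isSquarefreeList (hlen _ _)
        (IsSquarefreeList.zero_cons.mpr (IsSquarefreeList.succ_cons.mpr
          ⟨h, Finset.mem_compl.mp hj⟩))]
      simp [succSupport_zero_cons, succSupport_succ_cons, ha, hS, hk]
    · refine eval_iterPDeriv_ZM_of_not_isSquarefreeList_of_length (hlen _ _) (fun h' => hj ?_) w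
      exact Finset.mem_compl.mpr (IsSquarefreeList.succ_cons.mp h'.of_cons).2
  have hij : ∀ i ∈ Sᶜ, ∀ j ∈ Sᶜ, H i.succ j.succ =
      if i = j then 0 else k.factorial * a (insert i (insert j S)) := by
    intro i hi j hj
    rw [Finset.mem_compl] at hi hj
    rw [hH, hessian_iterPDeriv_apply]
    split_ifs with e
    · refine eval_iterPDeriv_ZM_of_not_isSquarefreeList_of_length (hlen _ _) (fun h' => ?_) w
      have := (IsSquarefreeList.succ_cons.mp h').2
      simp [succSupport_succ_cons, e] at this
    · rw [eval_iterPDeriv_ZM_of_isSquarefreeList (hlen _ _)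
        (IsSquarefreeList.succ_cons.mpr ⟨IsSquarefreeList.succ_cons.mpr ⟨h, hj⟩, by
          simpa [succSupport_succ_cons, e] using hi⟩)]
      simp [succSupport_succ_cons, ha, hS, hk]
  have hij0 : ∀ i j, i ∉ Sᶜ ∨ j ∉ Sᶜ → H i.succ j.succ = 0 := by
    intro i j hc
    rw [hH, hessian_iterPDeriv_apply]
    refine eval_iterPDeriv_ZM_of_not_isSquarefreeList_of_length (hlen _ _) (fun h' => ?_) w
    have h1 := IsSquarefreeList.succ_cons.mp h'
    have h2 := IsSquarefreeList.succ_cons.mp h1.1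
    rw [succSupport_succ_cons, Finset.mem_insert, not_or] at h1
    simp only [Finset.mem_compl, not_not] at hc
    exact hc.elim h1.2.2 h2.2
  obtain ⟨f, hf⟩ := exists_parallel_class_map hrk S
  refine .of_nonpos_on_hyperplane hsymm (H 0) fun z hz => ?_
  set b := ∑ j ∈ Sᶜ, a (insert j S) * z j.succ with hb
  set c := ∑ i ∈ Sᶜ, ∑ j ∈ Sᶜ,
    (if i = j then 0 else a (insert i (insert j S)) * (z i.succ * z j.succ)) with hc
  have hrow : ∑ j : Fin n, H 0 j.succ * z j.succ = (k + 1).factorial * b := by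
    rw [hb, Finset.mul_sum, ← Finset.sum_subset (Finset.subset_univ Sᶜ)]
    · exact Finset.sum_congr rfl fun j hj => by rw [h0j, if_pos hj, mul_assoc]
    · intro j _ hj
      rw [h0j, if_neg hj, zero_mul]
  have hblock : ∑ i : Fin n, z i.succ * ∑ j : Fin n, H i.succ j.succ * z j.succ =
      k.factorial * c := by
    rw [hc, Finset.mul_sum, ← Finset.sum_subset (Finset.subset_univ Sᶜ)]
    · refine Finset.sum_congr rfl fun i hi => ?_
      rw [Finset.mul_sum, Finset.mul_sum, ← Finset.sum_subset (Finset.subset_univ Sᶜ)]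
      · refine Finset.sum_congr rfl fun j hj => ?_
        rw [hij i hi j hj]
        split_ifs <;> ring
      · intro j _ hj
        rw [hij0 i j (.inr hj), zero_mul, mul_zero]
    · intro i _ hi
      rw [Finset.sum_eq_zero fun j _ => by rw [hij0 i j (.inl hi), zero_mul], mul_zero]
  have hquad : z ⬝ᵥ H *ᵥ z = z 0 * (H 0 ⬝ᵥ z) + z 0 * ((k + 1).factorial * b)
      + k.factorial * c := by
    rw [← hblock, ← hrow]
    simp only [dotProduct, mulVec, Fin.sum_univ_succ (n := n), mul_add, Finset.sum_add_distrib,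
      Finset.mul_sum]
    have : ∀ i : Fin n, z i.succ * (H i.succ 0 * z 0) = z 0 * (H 0 i.succ * z i.succ) := by
      intro i
      rw [hsymm.apply 0 i.succ]; ring
    simp only [this]
    ring
  have hineq : (k + 2 : ℝ) * (a S * c) ≤ (k + 1) * b ^ 2 := by
    have h1 := card_mul_sum_le_card_sub_one_mul_sq Sᶜ f hq0.le hq1
      (fun j => a (insert j S) * z j.succ)
    have h2 : a S * c = ∑ i ∈ Sᶜ, ∑ j ∈ Sᶜ, (if i = j then 0 else (if f i = f j then q else 1) *
        (a (insert i S) * z i.succ * (a (insert j S) * z j.succ))) := by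
      rw [hc, Finset.mul_sum]
      refine Finset.sum_congr rfl fun i _ => ?_
      rw [Finset.mul_sum]
      refine Finset.sum_congr rfl fun j _ => ?_
      by_cases e : i = j
      · simp [e]
      · have h3 := zpow_neg_rank_mul hrk hq0 hf e
        rw [if_neg e, if_neg e, ← mul_assoc (a S), ha, h3]
        ring
    rw [h2]
    rw [hcard] at h1
    push_cast at h1
    linarith
  have haS : 0 < a S := zpow_pos hq0 _
  have hfac1 : ((k + 1).factorial : ℝ) = (k + 1) * k.factorial := by
    rw [Nat.factorial_succ]; push_cast; ring
  have hfac2 : ((k + 2).factorial : ℝ) = (k + 2) * ((k + 1) * k.factorial) := by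
    rw [Nat.factorial_succ, Nat.cast_mul, hfac1]; push_cast; ring
  have hkpos : (0 : ℝ) < k.factorial := by positivity
  have hz0 : b = -((k + 2) * a S * z 0) := by
    have h1 : H 0 ⬝ᵥ z = H 0 0 * z 0 + ∑ j : Fin n, H 0 j.succ * z j.succ := by
      rw [dotProduct, Fin.sum_univ_succ]
    rw [h1, h00, hrow, hfac1, hfac2] at hz
    have h2 : ((k + 1) * k.factorial : ℝ) * ((k + 2) * a S * z 0 + b) = 0 := by linarith
    have h3 : ((k + 1) * k.factorial : ℝ) ≠ 0 := by positivity
    linarith [(mul_eq_zero.mp h2).resolve_left h3]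
  have hcle : c ≤ (k + 1) * (k + 2) * a S * z 0 ^ 2 := by
    rw [hz0] at hineq
    have h1 : (0 : ℝ) < (k + 2) * a S := by positivity
    refine le_of_mul_le_mul_left ?_ h1
    linarith
  rw [hquad, hz, hfac1, hz0]
  linarith [mul_le_mul_of_nonneg_left hcle hkpos.le]

/-- All iterated derivatives of the Tutte polynomial have Lorentzian Hessians. -/
lemma isLorentzianForm_hessian_iterPDeriv (hrk : IsMatroidRank n rk) (hq0 : 0 < q) (hq1 : q ≤ 1)
    {w : Fin (n + 1) → ℝ} (hw : ∀ i, 0 < w i) (d : ℕ) (L : List (Fin (n + 1)))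
    (hL : L.length + 2 + d = n) : IsLorentzianForm (hessian (iterPDeriv L (ZM n q rk)) w) := by
  have hsign : ∀ L' : List (Fin (n + 1)), L'.length ≤ n → _ := fun L' hL' =>
    eval_iterPDeriv_ZM_pos_or_eq_zero (rk := rk) hq0 hw (n - L'.length) L' (by omega)
  have hzero : ∀ L : List (Fin (n + 1)), L.length + 2 ≤ n → ¬ IsSquarefreeList L →
      hessian (iterPDeriv L (ZM n q rk)) w = 0 := by
    intro L hL h
    ext i j
    exact (hsign (i :: j :: L) (by simp; omega)).2 fun h' => h h'.of_cons.of_cons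
  induction d generalizing L with
  | zero =>
    by_cases h : IsSquarefreeList L
    · exact isLorentzianForm_hessian_of_length_add_two hrk hq0 hq1 hL h w
    · rw [hzero L (by omega) h]
      exact isLorentzianForm_zero
  | succ d ih =>
    by_cases h : IsSquarefreeList L
    swap
    · rw [hzero L (by omega) h]
      exact isLorentzianForm_zero
    have hE : ∀ i j, ∑ l, w l * eval w (iterPDeriv (l :: i :: j :: L) (ZM n q rk)) =
        ((d + 1 : ℕ) : ℝ) * eval w (iterPDeriv (i :: j :: L) (ZM n q rk)) := by
      intro i j
      rw [sum_mul_eval_iterPDeriv_cons (isHomogeneous_ZM q rk)]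
      congr 2
      simp
      omega
    refine IsLorentzianForm.of_derivatives
      (T := fun i => hessian (iterPDeriv (i :: L) (ZM n q rk)) w) (w := w) (c := (d + 1 : ℕ))
      (o := 0) (by positivity) hw (isSymm_hessian _ _) (fun i j => ?_) (fun i => ?_)
      (fun i => ih (i :: L) (by simp; omega)) (fun j k => ?_) (fun i j => ?_)
    · have hs := hsign (i :: j :: L) (by simp; omega)
      by_cases h' : IsSquarefreeList (i :: j :: L)
      · exact (hs.1 h').le
      · exact (hs.2 h').ge
    · by_cases h' : IsSquarefreeList (i :: L)
      · left
        rw [hessian_iterPDeriv_apply, iterPDeriv_perm (List.Perm.swap 0 i L)]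
        exact (hsign _ (by simp; omega)).1 (IsSquarefreeList.zero_cons.mpr h')
      · right
        refine ⟨fun j => ?_, ?_⟩
        · rw [hessian_iterPDeriv_apply, iterPDeriv_perm (List.Perm.swap j i L)]
          exact (hsign _ (by simp; omega)).2 fun h'' => h' h''.of_cons
        · exact hzero (i :: L) (by simp; omega) h'
    · rw [hessian_iterPDeriv_apply, ← hE]
      refine Finset.sum_congr rfl fun i _ => ?_
      rw [hessian_iterPDeriv_apply, iterPDeriv_perm (((List.Perm.swap i k L).cons j).trans
        (List.Perm.swap i j (k :: L)))]
    · rw [hessian_iterPDeriv_apply, ← hE, mulVec, dotProduct]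
      refine Finset.sum_congr rfl fun k _ => ?_
      rw [hessian_iterPDeriv_apply, mul_comm, iterPDeriv_perm ((List.Perm.swap k j (i :: L)).trans
        ((List.Perm.swap i j L).cons k))]

end Hessian

theorem statement0 (n : ℕ) (hn : 2 ≤ n) (rk : Finset (Fin n) → ℕ)
    (hrk : IsMatroidRank n rk) (q : ℝ) (hq0 : 0 < q) (hq1 : q ≤ 1)
    (w : Fin (n+1) → ℝ) (hw : ∀ i, 0 < w i)
    (hH : (hessian (ZM n q rk) w).IsHermitian) :
    Fintype.card {i // 0 < hH.eigenvalues i} = 1 := by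
  have hsign : ∀ i j, _ := fun i j =>
    eval_iterPDeriv_ZM_pos_or_eq_zero (rk := rk) hq0 hw (n - 2) [i, j] (by simp; omega)
  refine IsLorentzianForm.card_pos_eigenvalues
    (isLorentzianForm_hessian_iterPDeriv hrk hq0 hq1 hw (n - 2) [] (by simp; omega)) hH w ?_
  have hnn : ∀ i j, 0 ≤ hessian (ZM n q rk) w i j := by
    intro i j
    by_cases h : IsSquarefreeList [i, j]
    · exact ((hsign i j).1 h).le
    · exact ((hsign i j).2 h).ge
  have h00 : 0 < hessian (ZM n q rk) w 0 0 :=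
    (hsign 0 0).1 (IsSquarefreeList.zero_cons.mpr (IsSquarefreeList.zero_cons.mpr fun _ => by simp))
  change 0 < ∑ i, w i * ∑ j, hessian (ZM n q rk) w i j * w j
  refine Finset.sum_pos' (fun i _ => mul_nonneg (hw i).le
    (Finset.sum_nonneg fun j _ => mul_nonneg (hnn i j) (hw j).le)) ⟨0, Finset.mem_univ _,
      mul_pos (hw 0) (Finset.sum_pos' (fun j _ => mul_nonneg (hnn 0 j) (hw j).le)
        ⟨0, Finset.mem_univ _, mul_pos h00 (hw 0)⟩)⟩
end

section
/- Let A be an n×n real symmetric matrix with at least one positive eigenvalue. Then the following three statements are equivalent: (1) A has exactly one positive eigenvalue (counted with multiplicity); (2) for all u, v ∈ ℝ^n with uᵀAu > 0, one has (uᵀAv)² ≥ (uᵀAu)(vᵀAv); (3) there exists a vector u ∈ ℝ^n with uᵀAu > 0 such that (uᵀAv)² ≥ (uᵀAu)(vᵀAv) for all v ∈ ℝ^n. -/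
open Matrix

namespace Matrix.IsHermitian

variable {ι : Type*} [Fintype ι] {A : Matrix ι ι ℝ}

lemma dotProduct_mulVec_comm_real (hA : A.IsHermitian) (u v : ι → ℝ) :
    u ⬝ᵥ A *ᵥ v = v ⬝ᵥ A *ᵥ u := by
  have hT : Aᵀ = A := by simpa [conjTranspose_eq_transpose_of_trivial] using hA.eq
  rw [dotProduct_mulVec, ← mulVec_transpose, hT, dotProduct_comm]

/-- The quadratic form of `A` on a linear combination of two vectors. -/
lemma quadForm_smul_add_smul (hA : A.IsHermitian) (x y : ℝ) (u v : ι → ℝ) :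
    (x • u + y • v) ⬝ᵥ A *ᵥ (x • u + y • v) =
      x ^ 2 * (u ⬝ᵥ A *ᵥ u) + 2 * x * y * (u ⬝ᵥ A *ᵥ v) + y ^ 2 * (v ⬝ᵥ A *ᵥ v) := by
  simp only [mulVec_add, mulVec_smul, dotProduct_add, add_dotProduct, dotProduct_smul,
    smul_dotProduct, smul_eq_mul, hA.dotProduct_mulVec_comm_real v u]
  ring

variable [DecidableEq ι]

lemma eigenvectorBasis_dotProduct (hA : A.IsHermitian) (i j : ι) :
    (hA.eigenvectorBasis i).ofLp ⬝ᵥ (hA.eigenvectorBasis j).ofLp = if i = j then 1 else 0 := by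
  have h := orthonormal_iff_ite.mp hA.eigenvectorBasis.orthonormal i j
  rwa [EuclideanSpace.inner_eq_star_dotProduct, star_trivial, dotProduct_comm] at h

/-- The quadratic form of `A` in coordinates along an orthonormal eigenbasis. -/
lemma quadForm_eq_sum_eigenvalues (hA : A.IsHermitian) (v : ι → ℝ) :
    v ⬝ᵥ A *ᵥ v =
      ∑ i, hA.eigenvalues i * (v ⬝ᵥ (hA.eigenvectorBasis i).ofLp) ^ 2 := by
  have h := hA.eigenvectorBasis.sum_inner_mul_inner (WithLp.toLp 2 (A *ᵥ v)) (WithLp.toLp 2 v)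
  simp only [EuclideanSpace.inner_eq_star_dotProduct, star_trivial] at h
  rw [← h]
  refine Finset.sum_congr rfl fun i _ => ?_
  rw [dotProduct_comm _ (A *ᵥ v), dotProduct_comm (A *ᵥ v),
    hA.dotProduct_mulVec_comm_real, hA.mulVec_eigenvectorBasis, dotProduct_smul, smul_eq_mul]
  ring

/-- Reverse Cauchy-Schwarz inequality for a form with at most one positive eigenvalue. -/
lemma quadForm_mul_le_sq_of_eigenvalues_nonpos (hA : A.IsHermitian) {k : ι}
    (hk : ∀ i, i ≠ k → hA.eigenvalues i ≤ 0) {u : ι → ℝ} (hu : 0 < u ⬝ᵥ A *ᵥ u) (v : ι → ℝ) :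
    (u ⬝ᵥ A *ᵥ u) * (v ⬝ᵥ A *ᵥ v) ≤ (u ⬝ᵥ A *ᵥ v) ^ 2 := by
  have hneg (w : ι → ℝ) (hw : w ⬝ᵥ (hA.eigenvectorBasis k).ofLp = 0) : w ⬝ᵥ A *ᵥ w ≤ 0 := by
    rw [hA.quadForm_eq_sum_eigenvalues]
    refine Finset.sum_nonpos fun i _ => ?_
    obtain rfl | hi := eq_or_ne i k
    · simp [hw]
    · exact mul_nonpos_of_nonpos_of_nonneg (hk i hi) (sq_nonneg _)
  set a := u ⬝ᵥ (hA.eigenvectorBasis k).ofLp with ha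
  set b := v ⬝ᵥ (hA.eigenvectorBasis k).ofLp with hb
  have ha0 : a ≠ 0 := fun h => (hneg u h).not_gt hu
  have hw := hneg (b • u + (-a) • v) (by
    simp only [add_dotProduct, smul_dotProduct, smul_eq_mul, ← ha, ← hb]
    ring)
  rw [hA.quadForm_smul_add_smul] at hw
  refine le_of_mul_le_mul_left ?_ (sq_pos_of_ne_zero ha0)
  nlinarith [mul_nonneg hu.le (neg_nonneg.mpr hw),
    sq_nonneg (a * (u ⬝ᵥ A *ᵥ v) - b * (u ⬝ᵥ A *ᵥ u))]

/-- A vector satisfying the reverse Cauchy-Schwarz inequality forces all positive eigenvalues to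
sit at a single index. -/
lemma eq_of_eigenvalues_pos_of_quadForm_mul_le_sq (hA : A.IsHermitian) {u : ι → ℝ}
    (hu : 0 < u ⬝ᵥ A *ᵥ u)
    (h : ∀ v : ι → ℝ, (u ⬝ᵥ A *ᵥ u) * (v ⬝ᵥ A *ᵥ v) ≤ (u ⬝ᵥ A *ᵥ v) ^ 2)
    {i j : ι} (hi : 0 < hA.eigenvalues i) (hj : 0 < hA.eigenvalues j) : i = j := by
  by_contra hij
  set e := (hA.eigenvectorBasis i).ofLp with he
  set f := (hA.eigenvectorBasis j).ofLp with hf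
  have hee : e ⬝ᵥ A *ᵥ e = hA.eigenvalues i := by
    simp [he, hA.mulVec_eigenvectorBasis, hA.eigenvectorBasis_dotProduct]
  have hff : f ⬝ᵥ A *ᵥ f = hA.eigenvalues j := by
    simp [hf, hA.mulVec_eigenvectorBasis, hA.eigenvectorBasis_dotProduct]
  have hef : e ⬝ᵥ A *ᵥ f = 0 := by
    simp [he, hf, hA.mulVec_eigenvectorBasis, hA.eigenvectorBasis_dotProduct, hij]
  have hnonpos (x y : ℝ) (hxy : x * (u ⬝ᵥ A *ᵥ e) + y * (u ⬝ᵥ A *ᵥ f) = 0) :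
      x ^ 2 * hA.eigenvalues i + y ^ 2 * hA.eigenvalues j ≤ 0 := by
    have hw := h (x • e + y • f)
    have huw : u ⬝ᵥ A *ᵥ (x • e + y • f) = 0 := by
      simpa [mulVec_add, mulVec_smul] using hxy
    rw [huw, hA.quadForm_smul_add_smul, hee, hff, hef] at hw
    nlinarith
  by_cases hue : u ⬝ᵥ A *ᵥ e = 0
  · linarith [hnonpos 1 0 (by simp [hue])]
  · have hle := hnonpos (u ⬝ᵥ A *ᵥ f) (-(u ⬝ᵥ A *ᵥ e)) (by ring)
    rw [neg_sq] at hle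
    have := mul_pos (sq_pos_of_ne_zero hue) hj
    have := mul_nonneg (sq_nonneg (u ⬝ᵥ A *ᵥ f)) hi.le
    linarith

end Matrix.IsHermitian

theorem statement3 (n : ℕ) (A : Matrix (Fin n) (Fin n) ℝ) (hA : A.IsHermitian)
    (hpos : ∃ i, 0 < hA.eigenvalues i) :
    List.TFAE [
      Fintype.card {i // 0 < hA.eigenvalues i} = 1,
      ∀ u v : Fin n → ℝ, 0 < u ⬝ᵥ A.mulVec u →
        (u ⬝ᵥ A.mulVec u) * (v ⬝ᵥ A.mulVec v) ≤ (u ⬝ᵥ A.mulVec v) ^ 2,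
      ∃ u : Fin n → ℝ, 0 < u ⬝ᵥ A.mulVec u ∧
        ∀ v : Fin n → ℝ, (u ⬝ᵥ A.mulVec u) * (v ⬝ᵥ A.mulVec v) ≤ (u ⬝ᵥ A.mulVec v) ^ 2] := by
  obtain ⟨k, hk⟩ := hpos
  tfae_have 1 → 2 := by
    intro hcard u v hu
    have := Fintype.card_le_one_iff_subsingleton.mp hcard.le
    refine hA.quadForm_mul_le_sq_of_eigenvalues_nonpos (k := k) (fun i hik => ?_) hu v
    by_contra! hi
    exact hik (congrArg Subtype.val (Subsingleton.elim
      (⟨i, hi⟩ : {i // 0 < hA.eigenvalues i}) ⟨k, hk⟩))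
  tfae_have 2 → 3 := by
    intro h
    have hu : 0 < (hA.eigenvectorBasis k).ofLp ⬝ᵥ A *ᵥ (hA.eigenvectorBasis k).ofLp := by
      simpa [hA.mulVec_eigenvectorBasis, hA.eigenvectorBasis_dotProduct] using hk
    exact ⟨_, hu, fun v => h _ v hu⟩
  tfae_have 3 → 1 := by
    rintro ⟨u, hu, h⟩
    exact Fintype.card_eq_one_iff.mpr ⟨⟨k, hk⟩, fun i => Subtype.ext
      (hA.eq_of_eigenvalues_pos_of_quadForm_mul_le_sq hu h i.2 hk)⟩
  tfae_finish
end

section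
/- Let n ≥ 2, let M be a matroid on [n], and let 0 < q ≤ 1. Then for all w = (w_1,…,w_n) ∈ ℝ^n, Z^1_M(q, w)² ≥ 2·(n/(n−1))·Z^2_M(q, w). -/
open MvPolynomial Finset

lemma sum_offDiag_pair {ι R : Type*} [Fintype ι] [DecidableEq ι] [CommSemiring R]
    (g : Finset ι → R) :
    ∑ p ∈ (univ : Finset ι).offDiag, g {p.1, p.2} = 2 * ∑ A ∈ powersetCard 2 univ, g A := by
  rw [mul_sum, ← sum_fiberwise_of_maps_to (t := powersetCard 2 univ)
    (g := fun p : ι × ι => ({p.1, p.2} : Finset ι))]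
  · refine sum_congr rfl fun A hA => ?_
    obtain ⟨a, b, hab, rfl⟩ := card_eq_two.1 (mem_powersetCard.1 hA).2
    have hfib : ((univ : Finset ι).offDiag.filter fun p => ({p.1, p.2} : Finset ι) = {a, b})
        = {(a, b), (b, a)} := by
      ext ⟨x, y⟩
      simp only [mem_filter, mem_offDiag, mem_univ, true_and, mem_insert, mem_singleton,
        Prod.mk.injEq]
      constructor
      · rintro ⟨hxy, h⟩
        have hx : x ∈ ({a, b} : Finset ι) := h ▸ mem_insert_self x {y}
        have hy : y ∈ ({a, b} : Finset ι) := h ▸ mem_insert_of_mem (mem_singleton_self y)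
        simp only [mem_insert, mem_singleton] at hx hy
        grind
      · rintro (⟨rfl, rfl⟩ | ⟨rfl, rfl⟩)
        · exact ⟨hab, rfl⟩
        · exact ⟨hab.symm, pair_comm _ _⟩
    rw [sum_congr rfl fun p hp => by rw [(mem_filter.1 hp).2], hfib, sum_const,
      card_pair (by grind), nsmul_eq_mul, Nat.cast_ofNat]
  · intro p hp
    exact mem_powersetCard.2 ⟨subset_univ _, card_pair (mem_offDiag.1 hp).2.2⟩

/-- Cauchy–Schwarz for the sums of `y` over the fibres of `f`. -/
lemma sq_sum_le_card_mul_sum_ite {ι : Type*} [Fintype ι] [DecidableEq ι]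
    (f : ι → ι) (y : ι → ℝ) :
    (∑ i, y i) ^ 2 ≤
      (Fintype.card ι : ℝ) * ∑ i, ∑ j, if f i = f j then y i * y j else 0 := by
  have hsum : ∑ i, y i = ∑ c, ∑ i with f i = c, y i := (sum_fiberwise _ _ _).symm
  have hsq : ∑ i, ∑ j, (if f i = f j then y i * y j else 0)
      = ∑ c, (∑ i with f i = c, y i) ^ 2 := by
    rw [← sum_fiberwise univ f]
    refine sum_congr rfl fun c _ => ?_
    rw [sq, sum_mul_sum]
    refine sum_congr rfl fun i hi => ?_
    rw [(mem_filter.1 hi).2, sum_filter]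
    exact sum_congr rfl fun j _ => by simp only [eq_comm]
  rw [hsum, hsq]
  exact sq_sum_le_card_mul_sum_sq

namespace IsMatroidRank

variable {n : ℕ} {rk : Finset (Fin n) → ℕ}

lemma singleton_le_one (h : IsMatroidRank n rk) (i : Fin n) : rk {i} ≤ 1 := by
  simpa using h.1 {i}

lemma le_pair_left (h : IsMatroidRank n rk) (i j : Fin n) : rk {i} ≤ rk {i, j} :=
  h.2.1 _ _ (by simp)

lemma le_pair_right (h : IsMatroidRank n rk) (i j : Fin n) : rk {j} ≤ rk {i, j} :=
  h.2.1 _ _ (by simp)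

lemma pair_le (h : IsMatroidRank n rk) (i j : Fin n) : rk {i, j} ≤ rk {i} + rk {j} :=
  (Nat.le_add_right _ _).trans (h.2.2 {i} {j})

/-- Equality or parallelism of nonloops. -/
def parallel (h : IsMatroidRank n rk) : Setoid (Fin n) where
  r i j := i = j ∨ (rk {i} = 1 ∧ rk {j} = 1 ∧ rk {i, j} = 1)
  iseqv :=
    { refl := fun _ => Or.inl rfl
      symm := by
        rintro i j (rfl | ⟨hi, hj, hij⟩)
        · exact Or.inl rfl
        · exact Or.inr ⟨hj, hi, pair_comm i j ▸ hij⟩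
      trans := by
        rintro i j k (rfl | ⟨hi, hj, hij⟩) (rfl | ⟨hj', hk, hjk⟩)
        · exact Or.inl rfl
        · exact Or.inr ⟨hj', hk, hjk⟩
        · exact Or.inr ⟨hi, hj, hij⟩
        · refine Or.inr ⟨hi, hk, le_antisymm ?_ (hi ▸ h.le_pair_left i k)⟩
          have hsub := h.2.2 {i, j} {j, k}
          have hunion : rk {i, k} ≤ rk ({i, j} ∪ {j, k}) := h.2.1 _ _ (by grind)
          have hinter : rk {j} ≤ rk ({i, j} ∩ {j, k}) := h.2.1 _ _ (by grind)
          omega }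

lemma exists_parallel_rep (h : IsMatroidRank n rk) : ∃ f : Fin n → Fin n, ∀ i j,
    f i = f j ↔ i = j ∨ (rk {i} = 1 ∧ rk {j} = 1 ∧ rk {i, j} = 1) := by
  refine ⟨fun i => (Quotient.mk h.parallel i).out, fun i j => ?_⟩
  rw [Quotient.out_inj, Quotient.eq]
  rfl

lemma zpow_neg_pair (h : IsMatroidRank n rk) {q : ℝ} (hq : 0 < q) {i j : Fin n} (hij : i ≠ j)
    {f : Fin n → Fin n}
    (hf : ∀ i j, f i = f j ↔ i = j ∨ (rk {i} = 1 ∧ rk {j} = 1 ∧ rk {i, j} = 1)) :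
    q ^ (-(rk {i, j} : ℤ)) = (if f i = f j then q else 1) *
      (q ^ (-(rk {i} : ℤ)) * q ^ (-(rk {j} : ℤ))) := by
  have hi := h.singleton_le_one i
  have hj := h.singleton_le_one j
  have hl := h.le_pair_left i j
  have hr := h.le_pair_right i j
  have hle := h.pair_le i j
  rw [← zpow_add₀ hq.ne']
  split_ifs with hfij
  · obtain ⟨hi1, hj1, hij1⟩ := ((hf i j).1 hfij).resolve_left hij
    rw [← zpow_one_add₀ hq.ne', hi1, hj1, hij1]
    norm_num
  · have hnot : ¬ (rk {i} = 1 ∧ rk {j} = 1 ∧ rk {i, j} = 1) := fun hp =>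
      hfij ((hf i j).2 (Or.inr hp))
    rw [one_mul]
    congr 1
    omega

end IsMatroidRank

lemma eval_Zk_one (n : ℕ) (q : ℝ) (rk : Finset (Fin n) → ℕ) (w : Fin n → ℝ) :
    eval w (Zk n q rk 1) = ∑ i, q ^ (-(rk {i} : ℤ)) * w i := by
  simp [Zk, powersetCard_one]

lemma two_mul_eval_Zk_two (n : ℕ) (q : ℝ) (rk : Finset (Fin n) → ℕ) (w : Fin n → ℝ) :
    2 * eval w (Zk n q rk 2) =
      ∑ p ∈ (univ : Finset (Fin n)).offDiag, q ^ (-(rk {p.1, p.2} : ℤ)) * (w p.1 * w p.2) := by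
  have h := sum_offDiag_pair fun A : Finset (Fin n) => q ^ (-(rk A : ℤ)) * ∏ i ∈ A, w i
  have heval : eval w (Zk n q rk 2)
      = ∑ A ∈ powersetCard 2 univ, q ^ (-(rk A : ℤ)) * ∏ i ∈ A, w i := by
    simp only [Zk, map_sum, map_mul, map_prod, eval_C, eval_X]
  rw [heval, ← h]
  exact sum_congr rfl fun p hp => by rw [prod_pair (mem_offDiag.1 hp).2.2]

theorem statement5 (n : ℕ) (hn : 2 ≤ n) (rk : Finset (Fin n) → ℕ)
    (hrk : IsMatroidRank n rk) (q : ℝ) (hq0 : 0 < q) (hq1 : q ≤ 1)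
    (w : Fin n → ℝ) :
    2 * ((n : ℝ) / ((n : ℝ) - 1)) * eval w (Zk n q rk 2) ≤ (eval w (Zk n q rk 1)) ^ 2 := by
  obtain ⟨f, hf⟩ := hrk.exists_parallel_rep
  set y : Fin n → ℝ := fun i => q ^ (-(rk {i} : ℤ)) * w i with hy
  have hn' : (2 : ℝ) ≤ n := by exact_mod_cast hn
  have hZ₁ : eval w (Zk n q rk 1) = ∑ i, y i := eval_Zk_one n q rk w
  have hid := sq_sum_le_card_mul_sum_ite id y
  have hcl := sq_sum_le_card_mul_sum_ite f y
  have hZ₂ : 2 * eval w (Zk n q rk 2) = (∑ i, y i) ^ 2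
      - q * (∑ i, ∑ j, if id i = id j then y i * y j else 0)
      - (1 - q) * (∑ i, ∑ j, if f i = f j then y i * y j else 0) := by
    rw [two_mul_eval_Zk_two, sq, sum_mul_sum]
    simp only [← Fintype.sum_prod_type', mul_sum, ← sum_sub_distrib]
    refine sum_subset_zero_on_sdiff (subset_univ _) (fun p hp => ?_) fun p hp => ?_
    · have hp' : p.1 = p.2 := by simpa using hp
      simp only [hp', if_true]
      ring
    · have hne := (mem_offDiag.1 hp).2.2
      rw [hrk.zpow_neg_pair hq0 hne hf]
      simp only [id, if_neg hne, hy]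
      split_ifs <;> ring
  rw [Fintype.card_fin] at hid hcl
  rw [hZ₁, mul_right_comm, hZ₂, mul_div_assoc', div_le_iff₀ (by linarith)]
  linarith [mul_le_mul_of_nonneg_left hid hq0.le, mul_le_mul_of_nonneg_left hcl (sub_nonneg.2 hq1)]
end

section
/- Let n ≥ 2, let M be a matroid on [n], and let 0 < q ≤ 1. If w ∈ ℝ^n is nonzero and Z^1_M(q, w) = 0, then Z^2_M(q, w) < 0. -/
open MvPolynomial Finset

theorem IsMatroidRank.pair_eq_one_trans {n : ℕ} {rk : Finset (Fin n) → ℕ}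
    (h : IsMatroidRank n rk) {i j k : Fin n} (hi : rk {i} = 1) (hj : rk {j} = 1)
    (hij : rk {i, j} = 1) (hjk : rk {j, k} = 1) : rk {i, k} = 1 := by
  obtain ⟨-, hmono, hsub⟩ := h
  have h₁ := hsub {i, j} {j, k}
  have h₂ : rk {j} ≤ rk ({i, j} ∩ {j, k}) := hmono _ _ (by intro x; simp; tauto)
  have h₃ : rk {i, k} ≤ rk ({i, j} ∪ {j, k}) := hmono _ _ (by intro x; simp; tauto)
  have h₄ : rk {i} ≤ rk {i, k} := hmono _ _ (by intro x; simp; tauto)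
  omega

/-- Equality, or being parallel nonloops. -/
def IsMatroidRank.parallel_s7 {n : ℕ} {rk : Finset (Fin n) → ℕ} (h : IsMatroidRank n rk) :
    Setoid (Fin n) where
  r i j := i = j ∨ (rk {i} = 1 ∧ rk {j} = 1 ∧ rk {i, j} = 1)
  iseqv :=
    { refl := fun _ => Or.inl rfl
      symm := by
        rintro i j (rfl | ⟨hi, hj, hij⟩)
        · exact Or.inl rfl
        · exact Or.inr ⟨hj, hi, by rwa [Finset.pair_comm]⟩
      trans := by
        rintro i j k (rfl | ⟨hi, hj, hij⟩) hjk
        · exact hjk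
        · rcases hjk with rfl | ⟨-, hk, hjk⟩
          · exact Or.inr ⟨hi, hj, hij⟩
          · exact Or.inr ⟨hi, hk, h.pair_eq_one_trans hi hj hij hjk⟩ }

open Classical in
theorem IsMatroidRank.zpow_neg_pair_s7 {n : ℕ} {rk : Finset (Fin n) → ℕ}
    (h : IsMatroidRank n rk) {q : ℝ} (hq : q ≠ 0) {i j : Fin n} (hij : i ≠ j) :
    q ^ (-(rk {i, j} : ℤ)) =
      (if h.parallel_s7 i j then q else 1) * (q ^ (-(rk {i} : ℤ)) * q ^ (-(rk {j} : ℤ))) := by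
  have hr : h.parallel_s7 i j ↔ (rk {i} = 1 ∧ rk {j} = 1 ∧ rk {i, j} = 1) :=
    or_iff_right hij
  obtain ⟨hcard, hmono, hsub⟩ := h
  have hi := hcard {i}
  have hj := hcard {j}
  have h₁ := hsub {i} {j}
  have h₂ : rk {i} ≤ rk {i, j} := hmono _ _ (by simp)
  have h₃ : rk {j} ≤ rk {i, j} := hmono _ _ (by simp)
  rw [Finset.card_singleton] at hi hj
  rw [← Finset.insert_eq] at h₁
  rw [← zpow_add₀ hq]
  split_ifs with hp
  · obtain ⟨a, b, c⟩ := hr.1 hp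
    rw [a, b, c, ← zpow_one_add₀ hq]
    norm_num
  · rw [hr] at hp
    rw [one_mul]
    congr 1
    omega

open Classical in
theorem sum_sum_setoid_nonneg {ι : Type*} [Fintype ι] (s : Setoid ι) (x : ι → ℝ) :
    0 ≤ ∑ i, ∑ j, if s i j then x i * x j else 0 := by
  have h : ∑ i, ∑ j, (if s i j then x i * x j else 0) =
      ∑ c : Quotient s, (∑ i, if Quotient.mk s i = c then x i else 0) ^ 2 := by
    simp_rw [sq, Finset.sum_mul_sum]
    conv_rhs => rw [Finset.sum_comm]; enter [2, i]; rw [Finset.sum_comm]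
    refine Finset.sum_congr rfl fun i _ => Finset.sum_congr rfl fun j _ => ?_
    have : s i j ↔ Quotient.mk s i = Quotient.mk s j := Quotient.eq.symm
    simp [ite_mul, this]
  rw [h]
  positivity

theorem sum_offDiag_eq_two_mul_sum_powersetCard {ι : Type*} [DecidableEq ι] (s : Finset ι)
    (f : Finset ι → ℝ) :
    ∑ p ∈ s.offDiag, f {p.1, p.2} = 2 * ∑ A ∈ s.powersetCard 2, f A := by
  have hmap : ∀ p ∈ s.offDiag, ({p.1, p.2} : Finset ι) ∈ s.powersetCard 2 := by
    intro p hp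
    rw [Finset.mem_offDiag] at hp
    rw [Finset.mem_powersetCard]
    exact ⟨by simp [Finset.insert_subset_iff, hp.1, hp.2.1], Finset.card_pair hp.2.2⟩
  rw [← Finset.sum_fiberwise_of_maps_to hmap, Finset.mul_sum]
  refine Finset.sum_congr rfl fun A hA => ?_
  obtain ⟨hAs, hA⟩ := Finset.mem_powersetCard.1 hA
  obtain ⟨a, b, hab, rfl⟩ := Finset.card_eq_two.1 hA
  have ha : a ∈ s := hAs (by simp)
  have hb : b ∈ s := hAs (by simp)
  have hfib : s.offDiag.filter (fun p => ({p.1, p.2} : Finset ι) = {a, b}) =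
      {(a, b), (b, a)} := by
    ext ⟨c, d⟩
    simp only [Finset.mem_filter, Finset.mem_offDiag, Finset.mem_insert, Finset.mem_singleton,
      Prod.mk.injEq]
    rw [← Finset.coe_inj, Finset.coe_pair, Finset.coe_pair, Set.pair_eq_pair_iff]
    grind
  rw [hfib, Finset.sum_pair (by simp [hab]), Finset.pair_comm b a, two_mul]

open Classical in
theorem sum_offDiag_setoid_neg {ι : Type*} [Fintype ι] (s : Setoid ι) {q : ℝ} (hq0 : 0 < q)
    (hq1 : q ≤ 1) {x : ι → ℝ} (hx : x ≠ 0) (hsum : ∑ i, x i = 0) :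
    ∑ p ∈ (Finset.univ : Finset ι).offDiag,
      (if s p.1 p.2 then q else 1) * (x p.1 * x p.2) < 0 := by
  have hsq : 0 < ∑ i, x i ^ 2 := by
    obtain ⟨i, hi⟩ := Function.ne_iff.1 hx
    exact Finset.sum_pos' (fun _ _ => sq_nonneg _) ⟨i, Finset.mem_univ i, sq_pos_of_ne_zero hi⟩
  have hall : ∑ i, ∑ j, (if s i j then q else 1) * (x i * x j) =
      (∑ i, x i) ^ 2 - (1 - q) * ∑ i, ∑ j, (if s i j then x i * x j else 0) := by
    rw [sq, Finset.sum_mul_sum, Finset.mul_sum, ← Finset.sum_sub_distrib]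
    refine Finset.sum_congr rfl fun i _ => ?_
    rw [Finset.mul_sum, ← Finset.sum_sub_distrib]
    refine Finset.sum_congr rfl fun j _ => ?_
    split_ifs <;> ring
  have hdiag : ∑ p ∈ (Finset.univ : Finset ι).diag,
      (if s p.1 p.2 then q else 1) * (x p.1 * x p.2) = q * ∑ i, x i ^ 2 := by
    rw [Finset.sum_diag, Finset.mul_sum]
    exact Finset.sum_congr rfl fun i _ => by rw [if_pos (s.refl i), sq]
  have hsplit := Finset.sum_union
    (f := fun p : ι × ι => (if s p.1 p.2 then q else 1) * (x p.1 * x p.2))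
    (Finset.disjoint_diag_offDiag (Finset.univ : Finset ι))
  rw [Finset.diag_union_offDiag, Finset.sum_product, hall, hdiag, hsum] at hsplit
  have h₁ := mul_nonneg (sub_nonneg.2 hq1) (sum_sum_setoid_nonneg s x)
  have h₂ := mul_pos hq0 hsq
  linarith

theorem statement7 (n : ℕ) (hn : 2 ≤ n) (rk : Finset (Fin n) → ℕ)
    (hrk : IsMatroidRank n rk) (q : ℝ) (hq0 : 0 < q) (hq1 : q ≤ 1)
    (w : Fin n → ℝ) (hw : w ≠ 0) (hZ1 : eval w (Zk n q rk 1) = 0) :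
    eval w (Zk n q rk 2) < 0 := by
  classical
  set x : Fin n → ℝ := fun i => q ^ (-(rk {i} : ℤ)) * w i with hx_def
  have hx : x ≠ 0 := by
    obtain ⟨i, hi⟩ := Function.ne_iff.1 hw
    exact Function.ne_iff.2 ⟨i, mul_ne_zero (zpow_ne_zero _ hq0.ne') hi⟩
  have hsum : ∑ i, x i = 0 := by
    simpa [Zk, Finset.powersetCard_one, map_sum, hx_def] using hZ1
  have heval : eval w (Zk n q rk 2) =
      ∑ A ∈ Finset.powersetCard 2 Finset.univ, q ^ (-(rk A : ℤ)) * ∏ i ∈ A, w i := by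
    simp only [Zk, map_sum, map_mul, eval_C, map_prod, eval_X]
  have hpairs := sum_offDiag_eq_two_mul_sum_powersetCard (Finset.univ : Finset (Fin n))
    fun A => q ^ (-(rk A : ℤ)) * ∏ i ∈ A, w i
  have hneg := sum_offDiag_setoid_neg hrk.parallel_s7 hq0 hq1 hx hsum
  have hcongr : ∑ p ∈ (Finset.univ : Finset (Fin n)).offDiag,
      q ^ (-(rk {p.1, p.2} : ℤ)) * ∏ i ∈ {p.1, p.2}, w i =
      ∑ p ∈ (Finset.univ : Finset (Fin n)).offDiag,
        (if hrk.parallel_s7 p.1 p.2 then q else 1) * (x p.1 * x p.2) := by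
    refine Finset.sum_congr rfl fun p hp => ?_
    have hne := (Finset.mem_offDiag.1 hp).2.2
    rw [Finset.prod_pair hne, hrk.zpow_neg_pair_s7 hq0.ne' hne]
    ring
  rw [heval]
  linarith
end
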